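/- arXiv:2012.00539 — 5 statements merged into one kernel-verified Lean document; each statement's English description precedes it below -/
import Mathlib

section
/- For every s ∈ ℂ with Re(s) > 3/2, E_0(s) = ζ(2s−1)/ζ(2s), where ζ is the Riemann zeta function. -/
open Complex

noncomputable section

/-- λ(a,c): i^{(1−c)/2}(a/c) if c odd, a even; i^{a/2}(c/a) if a odd, c even; 0 otherwise,
where i^x := e^{iπx/2}. -/
def lamb (a c : ℕ) : ℂ :=
  if Odd c ∧ Even a then
    Complex.exp (Real.pi * Complex.I * ((1 - (c : ℂ)) / 2) / 2) * (jacobiSym a c : ℂ)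
  else if Odd a ∧ Even c then
    Complex.exp (Real.pi * Complex.I * ((a : ℂ) / 2) / 2) * (jacobiSym c a : ℂ)
  else 0

/-- The Gauss sum γ_c(n) = c^{−1/2} Σ_{a=1}^{2c} λ(a,c) e^{−πina/c}. -/
def gaussG (c : ℕ) (n : ℤ) : ℂ :=
  (c : ℂ) ^ (-(1 : ℂ) / 2) *
    ∑ a ∈ Finset.Icc 1 (2 * c), lamb a c * Complex.exp (-Real.pi * Complex.I * n * a / c)

/-- The Dirichlet series E_n(s) = (1/2) Σ_{c ≥ 1 odd} γ_c(n) c^{−s}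
+ (1/2) Σ_{c ≥ 2 even} γ_c(n) (c/2)^{−s}. -/
def En (n : ℤ) (s : ℂ) : ℂ :=
  (1/2) * (∑' c : ℕ, if Odd c then gaussG c n * (c : ℂ) ^ (-s) else 0)
  + (1/2) * (∑' c : ℕ, if Even c ∧ c ≠ 0 then gaussG c n * ((c : ℂ) / 2) ^ (-s) else 0)


open scoped NumberTheorySymbols

theorem sum_Icc_eq_zero_of_mul_eq_neg {N u : ℕ} [NeZero N] {f : ℕ → ℤ}
    (hper : ∀ a, f (a % N) = f a) (hu : u.Coprime N) (hneg : ∀ a, f (u * a) = -f a) :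
    ∑ a ∈ Finset.Icc 1 N, f a = 0 := by
  have hsum : ∑ a ∈ Finset.Icc 1 N, f a = ∑ x : ZMod N, f x.val := by
    have hN : f N = f 0 := by rw [← hper N, Nat.mod_self]
    obtain ⟨n, rfl⟩ := Nat.exists_eq_succ_of_ne_zero (NeZero.ne N)
    rw [show Finset.Icc 1 n.succ = Finset.Ico 1 (n.succ + 1) from rfl,
      Finset.sum_Ico_eq_sum_range]
    change _ = ∑ x : Fin (n + 1), f x
    rw [Fin.sum_univ_eq_sum_range f (n + 1), Finset.sum_range_succ', ← hN,
      Nat.add_sub_cancel, Finset.sum_range_succ]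
    simp [add_comm]
  have hmul : ∑ x : ZMod N, f x.val = ∑ x : ZMod N, f ((u : ZMod N) * x).val :=
    (Equiv.sum_comp (Units.mulLeft (ZMod.unitOfCoprime u hu)) (fun x : ZMod N => f x.val)).symm
  have hval : ∀ x : ZMod N, f ((u : ZMod N) * x).val = -f x.val := fun x => by
    have : (u : ZMod N) * x = ((u * x.val : ℕ) : ZMod N) := by simp
    rw [this, ZMod.val_natCast, hper, hneg]
  rw [hsum]
  simp only [hval, Finset.sum_neg_distrib] at hmul
  linarith

theorem Nat.exists_eq_odd_prime_pow_mul_of_not_isSquare {n : ℕ} (hn : ¬IsSquare n) :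
    ∃ p k r, p.Prime ∧ n = p ^ (2 * k + 1) * r ∧ ¬p ∣ r := by
  have hn0 : n ≠ 0 := by rintro rfl; exact hn (IsSquare.zero)
  obtain ⟨a, b, hab, ha⟩ := Nat.sq_mul_squarefree n
  have ha1 : a ≠ 1 := by
    rintro rfl
    exact hn ⟨b, by rw [← hab]; ring⟩
  have hp := Nat.minFac_prime ha1
  have hb0 : b ^ 2 ≠ 0 := by rintro h; simp [h] at hab; exact hn0 hab.symm
  have hfa : a.factorization a.minFac = 1 :=
    le_antisymm (ha.natFactorization_le_one _)
      ((hp.dvd_iff_one_le_factorization ha.ne_zero).1 (Nat.minFac_dvd a))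
  have hfn : n.factorization a.minFac = 2 * b.factorization a.minFac + 1 := by
    rw [← hab, Nat.factorization_mul hb0 ha.ne_zero, Nat.factorization_pow]
    simp [hfa]
  refine ⟨a.minFac, b.factorization a.minFac, n / a.minFac ^ n.factorization a.minFac, hp, ?_,
    Nat.not_dvd_ordCompl hp hn0⟩
  rw [← hfn, Nat.ordProj_mul_ordCompl_eq_self]

theorem exists_jacobiSym_eq_neg_one_of_not_isSquare {d : ℕ} (hd : ¬IsSquare d) :
    ∃ u : ℕ, u % 4 = 1 ∧ J(d | u) = -1 := by
  obtain ⟨p, k, r, hp, rfl, hpr⟩ := Nat.exists_eq_odd_prime_pow_mul_of_not_isSquare hd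
  have := Fact.mk hp
  have hr0 : r ≠ 0 := by rintro rfl; simp at hpr
  have hcop : p.Coprime r := (hp.coprime_iff_not_dvd).2 hpr
  suffices h : ∃ u : ℕ, u % 4 = 1 ∧ J(p | u) = -1 ∧ J(r | u) = 1 by
    obtain ⟨u, h4, hpu, hru⟩ := h
    refine ⟨u, h4, ?_⟩
    push_cast
    rw [jacobiSym.mul_left, jacobiSym.pow_left, hpu, hru, pow_succ, pow_mul]
    norm_num
  rcases hp.eq_two_or_odd' with rfl | hodd
  · have hr : Odd r := Nat.odd_iff.2 (by omega)
    obtain ⟨u, hu8, hur⟩ := Nat.chineseRemainder (Nat.Coprime.pow_left 3 hcop) 5 1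
    have h8 : u % 8 = 5 := hu8
    have hu4 : u % 4 = 1 := by omega
    have huo : Odd u := Nat.odd_iff.2 (by omega)
    refine ⟨u, hu4, ?_, ?_⟩
    · rw [Nat.cast_ofNat, jacobiSym.at_two huo, ZMod.χ₈_nat_mod_eight, h8]
      decide
    · rw [jacobiSym.quadratic_reciprocity_one_mod_four' hr hu4,
        jacobiSym.mod_left' (Int.natCast_modEq_iff.2 hur)]
      simp
  · have hp2 : ringChar (ZMod p) ≠ 2 := by
      rw [ZMod.ringChar_zmod_n]
      rintro rfl
      exact absurd hodd (by decide)
    obtain ⟨x, hx⟩ := FiniteField.exists_nonsquare hp2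
    have hcop' : p.Coprime (4 * r) :=
      Nat.Coprime.mul_right ((Nat.coprime_two_right.2 hodd).pow_right 2) hcop
    obtain ⟨u, hup, hur⟩ := Nat.chineseRemainder hcop' x.val 1
    have hu4 : u % 4 = 1 := Nat.ModEq.of_mul_right r hur
    have huo : Odd u := Nat.odd_iff.2 (by omega)
    refine ⟨u, hu4, ?_, ?_⟩
    · rw [jacobiSym.quadratic_reciprocity_one_mod_four' hodd hu4,
        ZMod.nonsquare_iff_jacobiSym_eq_neg_one]
      have : (u : ZMod p) = x := by
        rw [(ZMod.natCast_eq_natCast_iff _ _ _).2 hup, ZMod.natCast_zmod_val]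
      simpa [this] using hx
    · rw [jacobiSym.mod_right _ huo, Int.natAbs_natCast, hur,
        Nat.mod_eq_of_lt (by omega), jacobiSym.one_right]

theorem sum_Icc_jacobiSym_eq_zero {c : ℕ} (hc : Odd c) (hsq : ¬IsSquare c) :
    ∑ a ∈ Finset.Icc 1 c, J(a | c) = 0 := by
  obtain ⟨u, hu4, hu⟩ := exists_jacobiSym_eq_neg_one_of_not_isSquare hsq
  have : NeZero c := ⟨hc.pos.ne'⟩
  have huc : J(u | c) = -1 := by rw [jacobiSym.quadratic_reciprocity_one_mod_four hu4 hc, hu]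
  refine sum_Icc_eq_zero_of_mul_eq_neg (u := u) (f := fun a => J(a | c))
    (fun a => ?_) ?_ fun a => ?_
  · rw [Int.natCast_mod, ← jacobiSym.mod_left]
  · by_contra h
    have := jacobiSym.eq_zero_iff_not_coprime (a := u) (b := c) |>.2 (by simpa using h)
    omega
  · push_cast
    rw [jacobiSym.mul_left, huc, neg_one_mul]

theorem sum_Icc_ite_odd_jacobiSym_eq_zero {e : ℤ} (he : e ≠ 0) {u : ℕ} (huo : Odd u)
    (hu : J(e | u) = -1) :
    ∑ a ∈ Finset.Icc 1 (4 * e.natAbs), (if Odd a then J(e | a) else 0) = 0 := by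
  have : NeZero (4 * e.natAbs) := ⟨by simpa using he⟩
  refine sum_Icc_eq_zero_of_mul_eq_neg (u := u) (f := fun a => if Odd a then J(e | a) else 0)
    (fun a => ?_) ?_ fun a => ?_
  · have hmod : Odd (a % (4 * e.natAbs)) ↔ Odd a := by
      rw [Nat.odd_iff, Nat.odd_iff, Nat.mod_mod_of_dvd _ (Dvd.intro (2 * e.natAbs) (by ring))]
    by_cases ha : Odd a
    · simp only [hmod, ha, if_true]
      exact (jacobiSym.mod_right e ha).symm
    · simp only [hmod, ha, if_false]
  · refine Nat.Coprime.mul_right ((Nat.coprime_two_right.2 huo).pow_right 2) ?_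
    have : NeZero u := ⟨huo.pos.ne'⟩
    by_contra h
    have := jacobiSym.eq_zero_iff_not_coprime (a := e) (b := u) |>.2
      (by rwa [Int.gcd_eq_natAbs_gcd_natAbs, Int.natAbs_natCast, Nat.gcd_comm])
    omega
  · by_cases ha : Odd a
    · simp only [huo.mul ha, ha, if_true]
      rw [jacobiSym.mul_right' e huo.pos.ne' ha.pos.ne', hu, neg_one_mul]
    · simp [Nat.odd_mul, ha]

theorem jacobiSym_neg_self {d : ℕ} (hd : 0 < d) : J(-(d : ℤ) | 4 * d - 1) = -1 := by
  have hodd : Odd (4 * d - 1) := Nat.odd_iff.2 (by omega)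
  have h4 : J(-(4 * d : ℤ) | 4 * d - 1) = J(-1 | 4 * d - 1) := by
    exact jacobiSym.mod_left' (Int.modEq_iff_dvd.2 ⟨1, by push_cast [show 1 ≤ 4 * d by omega]; ring⟩)
  have h : J(4 * -(d : ℤ) | 4 * d - 1) = J(-(d : ℤ) | 4 * d - 1) := by
    rw [jacobiSym.mul_left, jacobiSym.at_four hodd, one_mul]
  rw [← h, mul_neg, h4, jacobiSym.at_neg_one hodd, ZMod.χ₄_nat_three_mod_four (by omega)]

theorem Nat.totient_sq (n : ℕ) : (n ^ 2).totient = n * n.totient := by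
  rcases n.eq_zero_or_pos with rfl | hn
  · simp
  · have h := Nat.totient_gcd_mul_totient_mul n n
    rw [Nat.gcd_self, mul_assoc] at h
    rw [sq, Nat.eq_of_mul_eq_mul_left (Nat.totient_pos.2 hn) h, mul_comm]

theorem sum_Icc_ite_coprime (n : ℕ) :
    ∑ a ∈ Finset.Icc 1 n, (if n.Coprime a then (1 : ℤ) else 0) = n.totient := by
  rw [Finset.sum_boole, show Finset.Icc 1 n = Finset.Ico 1 (1 + n) by ext; simp; omega,
    Nat.filter_coprime_Ico_eq_totient]

theorem sum_Icc_two_mul_ite_even {M : Type*} [AddCommMonoid M] (g : ℕ → M) (n : ℕ) :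
    ∑ a ∈ Finset.Icc 1 (2 * n), (if Even a then g a else 0) =
      ∑ b ∈ Finset.Icc 1 n, g (2 * b) := by
  induction n with
  | zero => simp
  | succ n ih =>
    rw [Finset.sum_Icc_succ_top (by omega), ← ih, show 2 * (n + 1) = 2 * n + 1 + 1 by ring,
      Finset.sum_Icc_succ_top (by omega), Finset.sum_Icc_succ_top (by omega)]
    simp [Nat.even_add_one]

theorem jacobiSym_sq_right (a n : ℕ) [NeZero n] :
    J(a | n ^ 2) = if n.Coprime a then 1 else 0 := by
  rw [jacobiSym.pow_right]
  split_ifs with h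
  · exact jacobiSym.sq_one (by simpa using h.symm)
  · rw [jacobiSym.eq_zero_iff_not_coprime.2 (by simpa [Nat.gcd_comm] using h)]
    norm_num

theorem jacobiSym_sq_left (n a : ℕ) [NeZero a] :
    J((n ^ 2 : ℕ) | a) = if n.Coprime a then 1 else 0 := by
  push_cast
  rw [jacobiSym.pow_left]
  split_ifs with h
  · exact jacobiSym.sq_one (by simpa using h)
  · rw [jacobiSym.eq_zero_iff_not_coprime.2 (by simpa using h)]
    norm_num

theorem natCast_cpow_neg_one_div_two (c : ℕ) :
    (c : ℂ) ^ (-(1 : ℂ) / 2) = ((√(c : ℝ))⁻¹ : ℝ) := by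
  rw [Real.sqrt_eq_rpow, ← Real.rpow_neg c.cast_nonneg, Complex.ofReal_cpow c.cast_nonneg]
  push_cast
  ring_nf

theorem gaussG_zero (c : ℕ) :
    gaussG c 0 = ((√(c : ℝ))⁻¹ : ℝ) * ∑ a ∈ Finset.Icc 1 (2 * c), lamb a c := by
  simp [gaussG, natCast_cpow_neg_one_div_two]

theorem sum_lamb_of_odd {c : ℕ} (hc : Odd c) :
    ∑ a ∈ Finset.Icc 1 (2 * c), lamb a c =
      Complex.exp (Real.pi * Complex.I * ((1 - (c : ℂ)) / 2) / 2) *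
        ((J(2 | c) * ∑ b ∈ Finset.Icc 1 c, J(b | c) : ℤ) : ℂ) := by
  have h : ∀ a, lamb a c = if Even a then
      Complex.exp (Real.pi * Complex.I * ((1 - (c : ℂ)) / 2) / 2) * (J(a | c) : ℂ) else 0 := by
    intro a
    simp [lamb, hc, Nat.not_even_iff_odd.2 hc]
  simp only [h]
  rw [sum_Icc_two_mul_ite_even (fun a => Complex.exp (Real.pi * Complex.I * ((1 - (c : ℂ)) / 2) / 2) *
    (J(a | c) : ℂ)), Finset.mul_sum, Int.cast_sum, Finset.mul_sum]
  simp [jacobiSym.mul_left]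

theorem gaussG_zero_of_odd_of_not_isSquare {c : ℕ} (hc : Odd c) (hsq : ¬IsSquare c) :
    gaussG c 0 = 0 := by
  rw [gaussG_zero, sum_lamb_of_odd hc, sum_Icc_jacobiSym_eq_zero hc hsq]
  simp

theorem gaussG_sq_zero_of_odd {n : ℕ} (hn : Odd n) : gaussG (n ^ 2) 0 = n.totient := by
  have : NeZero n := ⟨hn.pos.ne'⟩
  have hn0 : (n : ℂ) ≠ 0 := Nat.cast_ne_zero.2 hn.pos.ne'
  have hexp : Complex.exp (Real.pi * Complex.I * ((1 - ((n ^ 2 : ℕ) : ℂ)) / 2) / 2) = 1 := by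
    obtain ⟨k, hk⟩ := Nat.eight_dvd_sq_sub_one_of_odd hn
    have h1 : n ^ 2 = 8 * k + 1 := by have : 0 < n ^ 2 := pow_pos hn.pos 2; omega
    rw [Complex.exp_eq_one_iff]
    refine ⟨-k, ?_⟩
    rw [h1]
    push_cast
    ring
  have hsum : ∑ b ∈ Finset.Icc 1 (n ^ 2), J(b | n ^ 2) = (n ^ 2).totient := by
    rw [← sum_Icc_ite_coprime]
    exact Finset.sum_congr rfl fun a _ => by
      simp only [jacobiSym_sq_right, Nat.coprime_pow_left_iff two_pos]
  have h2 : J(2 | n ^ 2) = 1 := by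
    have := jacobiSym_sq_right 2 n
    rwa [if_pos (Nat.coprime_two_right.2 hn)] at this
  rw [gaussG_zero, sum_lamb_of_odd hn.pow, hexp, hsum, h2, Nat.totient_sq, Nat.cast_pow,
    Real.sqrt_sq n.cast_nonneg]
  push_cast
  field_simp

theorem exp_mul_χ₈ {a : ℕ} (ha : Odd a) :
    Complex.exp (Real.pi * Complex.I * ((a : ℂ) / 2) / 2) * (ZMod.χ₈ a : ℂ) =
      ((√2)⁻¹ : ℝ) * (1 + Complex.I * (ZMod.χ₄ a : ℂ)) := by
  have hs : ((√2 : ℝ) : ℂ) ^ 2 = 2 := by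
    rw [← Complex.ofReal_pow, Real.sq_sqrt (by norm_num)]
    norm_num
  have hs0 : ((√2 : ℝ) : ℂ) ≠ 0 := by simp
  have hω : Complex.exp (Real.pi / 4 * Complex.I) = ((√2)⁻¹ : ℝ) * (1 + Complex.I) := by
    have := Complex.exp_mul_I ((Real.pi / 4 : ℝ) : ℂ)
    rw [← Complex.ofReal_cos, ← Complex.ofReal_sin, Real.cos_pi_div_four,
      Real.sin_pi_div_four] at this
    push_cast at this ⊢
    rw [this]
    field_simp
    rw [hs]
  have hω2 : Complex.exp (Real.pi / 4 * Complex.I) ^ 2 = Complex.I := by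
    rw [hω]
    push_cast
    rw [mul_pow, inv_pow, hs]
    linear_combination (1 / 2 : ℂ) * Complex.I_sq
  have hexp : Complex.exp (Real.pi * Complex.I * ((a : ℂ) / 2) / 2) =
      Complex.exp (Real.pi / 4 * Complex.I) ^ a := by
    rw [← Complex.exp_nat_mul]
    ring_nf
  have h8 : Complex.exp (Real.pi / 4 * Complex.I) ^ 8 = 1 := by
    rw [show 8 = 2 * 4 by rfl, pow_mul, hω2, Complex.I_pow_four]
  have hI : Complex.I ^ 2 = -1 := Complex.I_sq
  rw [hexp, ← Nat.div_add_mod a 8, pow_add, pow_mul, h8, one_pow, one_mul, Nat.div_add_mod a 8,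
    ZMod.χ₈_nat_mod_eight, ZMod.χ₄_nat_eq_if_mod_four, ← Nat.mod_mod_of_dvd a (by decide : 2 ∣ 8),
    ← Nat.mod_mod_of_dvd a (by decide : 4 ∣ 8)]
  have hodd : a % 8 % 2 = 1 := by have := Nat.odd_iff.1 ha; omega
  have hlt : a % 8 < 8 := Nat.mod_lt _ (by norm_num)
  generalize a % 8 = r at hodd hlt
  have e1 : ZMod.χ₈ ((1 : ℕ) : ZMod 8) = 1 := by decide
  have e3 : ZMod.χ₈ ((3 : ℕ) : ZMod 8) = -1 := by decide
  have e5 : ZMod.χ₈ ((5 : ℕ) : ZMod 8) = -1 := by decide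
  have e7 : ZMod.χ₈ ((7 : ℕ) : ZMod 8) = 1 := by decide
  interval_cases r <;> simp at hodd
  · rw [e1, pow_one, hω]; norm_num
  · rw [e3, pow_succ, hω2, hω]; norm_num; linear_combination (-(√2 : ℂ)⁻¹) * hI
  · rw [e5, pow_succ, show 4 = 2 * 2 by rfl, pow_mul, hω2, hω, hI]; norm_num
  · rw [e7, pow_succ, show 6 = 2 * 3 by rfl, pow_mul, hω2, hω, Complex.I_pow_three]; norm_num
    linear_combination (-(√2 : ℂ)⁻¹) * hI

theorem sum_lamb_two_mul (d : ℕ) :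
    ∑ a ∈ Finset.Icc 1 (2 * (2 * d)), lamb a (2 * d) =
      ((√2)⁻¹ : ℝ) * ((∑ a ∈ Finset.Icc 1 (4 * d), if Odd a then J(d | a) else 0 : ℤ) +
        Complex.I * (∑ a ∈ Finset.Icc 1 (4 * d), if Odd a then J(-d | a) else 0 : ℤ)) := by
  have hterm : ∀ a, lamb a (2 * d) = ((√2)⁻¹ : ℝ) * (((if Odd a then J(d | a) else 0 : ℤ) : ℂ) +
      Complex.I * ((if Odd a then J(-d | a) else 0 : ℤ) : ℂ)) := by
    intro a
    by_cases ha : Odd a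
    · have he : J(-d | a) = ZMod.χ₄ a * J(d | a) := by
        rw [← jacobiSym.at_neg_one ha, ← jacobiSym.mul_left, neg_one_mul]
      have h2 : J((2 * d : ℕ) | a) = ZMod.χ₈ a * J(d | a) := by
        rw [← jacobiSym.at_two ha, ← jacobiSym.mul_left]
        push_cast
        rfl
      simp only [lamb, ha, Nat.not_even_iff_odd.2 ha, even_two_mul, and_false, and_true, if_true,
        if_false]
      rw [h2, he]
      simp only [Int.cast_mul]
      linear_combination (J(d | a) : ℂ) * exp_mul_χ₈ ha
    · simp [lamb, ha]
  rw [show 2 * (2 * d) = 4 * d by ring]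
  simp only [hterm]
  rw [← Finset.mul_sum, Finset.sum_add_distrib, ← Finset.mul_sum]
  push_cast
  rfl

theorem sum_Icc_ite_odd_jacobiSym_neg {d : ℕ} (hd : 0 < d) :
    ∑ a ∈ Finset.Icc 1 (4 * d), (if Odd a then J(-d | a) else 0) = 0 := by
  have := sum_Icc_ite_odd_jacobiSym_eq_zero (e := -d) (by omega)
    (Nat.odd_iff.2 (by omega) : Odd (4 * d - 1)) (jacobiSym_neg_self hd)
  rwa [Int.natAbs_neg, Int.natAbs_natCast] at this

theorem gaussG_two_mul_zero_of_not_isSquare {d : ℕ} (hsq : ¬IsSquare d) :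
    gaussG (2 * d) 0 = 0 := by
  have hd : d ≠ 0 := by rintro rfl; exact hsq IsSquare.zero
  obtain ⟨u, hu4, hu⟩ := exists_jacobiSym_eq_neg_one_of_not_isSquare hsq
  have h := sum_Icc_ite_odd_jacobiSym_eq_zero (e := d) (by omega)
    (Nat.odd_iff.2 (by omega)) hu
  rw [Int.natAbs_natCast] at h
  rw [gaussG_zero, sum_lamb_two_mul, h, sum_Icc_ite_odd_jacobiSym_neg (Nat.pos_of_ne_zero hd)]
  simp

theorem gaussG_two_mul_sq_zero {n : ℕ} (hn : n ≠ 0) :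
    gaussG (2 * n ^ 2) 0 = (2 * n).totient := by
  have hs : ((√2 : ℝ) : ℂ) ^ 2 = 2 := by
    rw [← Complex.ofReal_pow, Real.sq_sqrt (by norm_num)]
    norm_num
  have hs0 : ((√2 : ℝ) : ℂ) ≠ 0 := by simp
  have hn0 : (n : ℂ) ≠ 0 := Nat.cast_ne_zero.2 hn
  have hsum : ∑ a ∈ Finset.Icc 1 (4 * n ^ 2), (if Odd a then J((n ^ 2 : ℕ) | a) else 0) =
      2 * n * (2 * n).totient := by
    have h := sum_Icc_ite_coprime ((2 * n) ^ 2)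
    rw [Nat.totient_sq, show (2 * n) ^ 2 = 4 * n ^ 2 by ring] at h
    push_cast at h
    rw [← h]
    refine Finset.sum_congr rfl fun a ha => ?_
    have : NeZero a := ⟨by have := (Finset.mem_Icc.1 ha).1; omega⟩
    rw [jacobiSym_sq_left, show 4 * n ^ 2 = (2 * n) ^ 2 by ring]
    simp [Nat.coprime_pow_left_iff two_pos, Nat.coprime_mul_iff_left, ← ite_and]
  rw [gaussG_zero, sum_lamb_two_mul, hsum, sum_Icc_ite_odd_jacobiSym_neg (by positivity)]
  push_cast
  rw [Real.sqrt_mul (by norm_num), Real.sqrt_sq n.cast_nonneg]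
  push_cast
  field_simp
  rw [hs]
  ring

theorem LSeriesSummable_natCast_of_le {f : ℕ → ℕ} {C : ℕ} (hf : ∀ n, f n ≤ C * n) {w : ℂ}
    (hw : 2 < w.re) : LSeriesSummable (fun n => (f n : ℂ)) w := by
  refine LSeriesSummable_of_le_const_mul_rpow hw ⟨C, fun n _ => ?_⟩
  rw [Complex.norm_natCast, show (2 : ℝ) - 1 = 1 by norm_num, Real.rpow_one]
  exact_mod_cast hf n

theorem LSeries_natCast_eq_riemannZeta {w : ℂ} (hw : 2 < w.re) :
    LSeries (fun n => (n : ℂ)) w = riemannZeta (w - 1) := by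
  rw [← LSeries_one_eq_riemannZeta (by simp; linarith)]
  refine tsum_congr fun n => ?_
  rcases eq_or_ne n 0 with rfl | hn
  · simp
  · have hn0 : (n : ℂ) ≠ 0 := Nat.cast_ne_zero.2 hn
    rw [LSeries.term_of_ne_zero hn, LSeries.term_of_ne_zero hn, Complex.cpow_sub _ _ hn0,
      Complex.cpow_one, Pi.one_apply, one_div_div]

theorem LSeries_totient_eq {w : ℂ} (hw : 2 < w.re) :
    LSeries (fun n => (n.totient : ℂ)) w = riemannZeta (w - 1) / riemannZeta w := by
  have hw1 : 1 < w.re := by linarith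
  rw [eq_div_iff (riemannZeta_ne_zero_of_one_lt_re hw1), ← LSeries_one_eq_riemannZeta hw1,
    ← LSeries_natCast_eq_riemannZeta hw,
    ← LSeries_convolution' (LSeriesSummable_natCast_of_le (C := 1)
      (fun n => by simpa using n.totient_le) hw) (LSeriesSummable_one_iff.2 hw1)]
  refine LSeries_congr (fun {n} _ => ?_) w
  rw [LSeries.convolution_def]
  simp only [Pi.one_apply, mul_one]
  rw [Nat.sum_divisorsAntidiagonal (fun i _ => (i.totient : ℂ)), ← Nat.cast_sum, Nat.sum_totient]

theorem natCast_sq_cpow_neg (n : ℕ) (s : ℂ) :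
    ((n ^ 2 : ℕ) : ℂ) ^ (-s) = ((n : ℂ) ^ (2 * s))⁻¹ := by
  rcases eq_or_ne n 0 with rfl | hn
  · rcases eq_or_ne s 0 with rfl | hs
    · simp
    · simp [hs]
  · rw [sq, Nat.cast_mul, Complex.natCast_mul_natCast_cpow,
      ← Complex.cpow_add _ _ (Nat.cast_ne_zero.2 hn), ← Complex.cpow_neg]
    ring_nf

theorem tsum_odd_gaussG_zero (s : ℂ) :
    (∑' c : ℕ, if Odd c then gaussG c 0 * (c : ℂ) ^ (-s) else 0) =
      LSeries (fun n => ((if Odd n then n.totient else 0 : ℕ) : ℂ)) (2 * s) := by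
  have hinj : Function.Injective (fun n : ℕ => n ^ 2) := Nat.pow_left_injective two_ne_zero
  rw [← hinj.tsum_eq]
  · refine tsum_congr fun n => ?_
    by_cases hn : Odd n
    · rw [if_pos hn.pow, LSeries.term_of_ne_zero hn.pos.ne', if_pos hn, gaussG_sq_zero_of_odd hn,
        natCast_sq_cpow_neg, div_eq_mul_inv]
    · have : ¬Odd (n ^ 2) := fun h => hn (Nat.odd_pow_iff two_ne_zero |>.1 h)
      rw [if_neg this, LSeries.term_def, if_neg hn]
      simp
  · intro c hc
    rw [Function.mem_support, ne_eq, ite_eq_right_iff, Classical.not_imp] at hc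
    by_contra hsq
    refine hc.2 ?_
    rw [gaussG_zero_of_odd_of_not_isSquare hc.1, zero_mul]
    rintro ⟨r, rfl⟩
    exact hsq ⟨r, sq r⟩

theorem tsum_even_gaussG_zero (s : ℂ) :
    (∑' c : ℕ, if Even c ∧ c ≠ 0 then gaussG c 0 * ((c : ℂ) / 2) ^ (-s) else 0) =
      LSeries (fun n => ((2 * n).totient : ℂ)) (2 * s) := by
  have hinj : Function.Injective (fun n : ℕ => 2 * n ^ 2) :=
    (mul_right_injective₀ two_ne_zero).comp (Nat.pow_left_injective two_ne_zero)
  rw [← hinj.tsum_eq]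
  · refine tsum_congr fun n => ?_
    rcases eq_or_ne n 0 with rfl | hn
    · simp
    · have hhalf : ((2 * n ^ 2 : ℕ) : ℂ) / 2 = (n ^ 2 : ℕ) := by push_cast; ring
      rw [if_pos ⟨even_two_mul _, by positivity⟩, LSeries.term_of_ne_zero hn,
        gaussG_two_mul_sq_zero hn, hhalf, natCast_sq_cpow_neg, div_eq_mul_inv]
  · intro c hc
    rw [Function.mem_support, ne_eq, ite_eq_right_iff, Classical.not_imp] at hc
    obtain ⟨⟨hev, -⟩, hne⟩ := hc
    obtain ⟨d, rfl⟩ := hev.two_dvd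
    by_contra hsq
    refine hne ?_
    rw [gaussG_two_mul_zero_of_not_isSquare, zero_mul]
    rintro ⟨r, rfl⟩
    exact hsq ⟨r, by simp only; ring⟩

theorem ite_odd_totient_add_totient_two_mul (n : ℕ) :
    (if Odd n then n.totient else 0) + (2 * n).totient = 2 * n.totient := by
  split_ifs with hn
  · rw [Nat.totient_two_mul_of_odd hn, two_mul]
  · rw [Nat.totient_two_mul_of_even (Nat.not_odd_iff_even.1 hn), zero_add]

/-- Zagier: E_0(s) = ζ(2s−1)/ζ(2s). -/
theorem En_zero_eq (s : ℂ) (hs : 3/2 < s.re) :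
    En 0 s = riemannZeta (2 * s - 1) / riemannZeta (2 * s) := by
  have hw : 2 < (2 * s).re := by
    simp only [Complex.mul_re, Complex.re_ofNat, Complex.im_ofNat]
    linarith
  have h1 : ∀ n : ℕ, (if Odd n then n.totient else 0) ≤ 1 * n := fun n => by
    split_ifs
    · simpa using n.totient_le
    · simp
  have hadd := LSeries_add (LSeriesSummable_natCast_of_le h1 hw)
    (LSeriesSummable_natCast_of_le (f := fun n => (2 * n).totient) (C := 2)
      (fun n => (2 * n).totient_le) hw)
  have htwo : ((fun n => ((if Odd n then n.totient else 0 : ℕ) : ℂ)) +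
      fun n : ℕ => ((2 * n).totient : ℂ)) = (2 : ℂ) • fun n => (n.totient : ℂ) := by
    funext n
    rw [Pi.add_apply, ← Nat.cast_add, ite_odd_totient_add_totient_two_mul]
    simp
  rw [htwo, LSeries_smul, LSeries_totient_eq hw] at hadd
  rw [En, tsum_odd_gaussG_zero, tsum_even_gaussG_zero, ← mul_add, ← hadd]
  ring

end
end

section
/- Let k ∈ ℤ, v > 0, h ∈ ℤ, and s ∈ ℂ with Re(s) > 3/4 − k/2, Re(s) > 0 and Re(k + 1/2 + s) > 0. Define ϱ_h^{k+1/2}(s,v) := v^{1/2−k−2s} e^{2πhv} ∫_{−∞}^{∞} (t+i)^{−(k+1/2)−s} (t−i)^{−s} e^{−2πihtv} dt. Then: (i) if h > 0, ϱ_h^{k+1/2}(s,v) = (−2πi)^{k+1/2} π^s Γ(k+1/2+s)^{−1} h^{k−1/2+s} v^{−s} Ω(4πhv; k+1/2+s, s); (ii) if h = 0, ϱ_0^{k+1/2}(s,v) = i^{−(k+1/2)} (2π) Γ(k+1/2+s)^{−1} Γ(s)^{−1} Γ(k−1/2+2s) (2v)^{1/2−k−2s}; (iii) if h < 0, ϱ_h^{k+1/2}(s,v)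 = (2i)^{−(k+1/2)} π^s Γ(s)^{−1} (−h)^{s−1} v^{−(k+1/2)−s} e^{4πhv} Ω(−4πhv; s, k+1/2+s). -/
open Complex MeasureTheory

noncomputable section

/-- The Fourier coefficient integral
ϱ_h^{k+1/2}(s,v) = v^{1/2−k−2s} e^{2πhv} ∫ (t+i)^{−(k+1/2)−s} (t−i)^{−s} e^{−2πihtv} dt. -/
def rho (k : ℤ) (s : ℂ) (h : ℤ) (v : ℝ) : ℂ :=
  (v : ℂ) ^ ((1 : ℂ)/2 - (k : ℂ) - 2 * s) * (Real.exp (2 * Real.pi * h * v) : ℂ) *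
    ∫ t : ℝ, ((t : ℂ) + Complex.I) ^ (-((k : ℂ) + 1/2) - s) * ((t : ℂ) - Complex.I) ^ (-s) *
      Complex.exp (-2 * Real.pi * Complex.I * h * t * v)

/-- Ω(y; α, β) = (y^β/Γ(β)) ∫₀^∞ e^{−yu} (u+1)^{α−1} u^{β−1} du. -/
def Omega (y : ℝ) (α β : ℂ) : ℂ :=
  (y : ℂ) ^ β / Complex.Gamma β *
    ∫ u in Set.Ioi (0 : ℝ), Complex.exp (-(y * u : ℝ)) * ((u : ℂ) + 1) ^ (α - 1) *
      (u : ℂ) ^ (β - 1)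

open Set Filter
open scoped Real FourierTransform

theorem integrableOn_cpow_mul_cexp {a r : ℂ} (ha : 0 < a.re) (hr : 0 < r.re) :
    IntegrableOn (fun x : ℝ ↦ (x : ℂ) ^ (a - 1) * cexp (-(r * x))) (Ioi 0) := by
  have hreal : IntegrableOn (fun x : ℝ ↦ (x : ℂ) ^ (a - 1) * cexp (-(r.re * x))) (Ioi 0) := by
    by_contra hnot
    have hint := integral_cpow_mul_exp_neg_mul_Ioi ha hr
    rw [integral_undef hnot] at hint
    refine mul_ne_zero ?_ (Gamma_ne_zero_of_re_pos ha) hint.symm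
    simp [cpow_eq_zero_iff, hr.ne']
  refine Integrable.mono hreal ?_ ?_
  · refine ContinuousOn.aestronglyMeasurable (fun x hx ↦ ?_) measurableSet_Ioi
    exact ((continuousAt_ofReal_cpow_const x _ (Or.inr (ne_of_gt hx))).mul
      (by fun_prop)).continuousWithinAt
  · refine Eventually.of_forall fun x ↦ le_of_eq ?_
    simp [norm_exp]

theorem mul_integral_cpow_mul_cexp {a r : ℂ} (ha : 0 < a.re) (hr : 0 < r.re) :
    r * ∫ x in Ioi (0 : ℝ), (x : ℂ) ^ (a + 1 - 1) * cexp (-(r * x)) =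
      a * ∫ x in Ioi (0 : ℝ), (x : ℂ) ^ (a - 1) * cexp (-(r * x)) := by
  have ha0 : a ≠ 0 := by rintro rfl; simp at ha
  have h1 := (integrableOn_cpow_mul_cexp ha hr).const_mul a
  have h2 := (integrableOn_cpow_mul_cexp (a := a + 1) (by simp; linarith) hr).const_mul r
  have hFTC := integral_Ioi_of_hasDerivAt_of_tendsto (a := (0 : ℝ)) (m := (0 : ℂ))
    (f := fun x : ℝ ↦ (x : ℂ) ^ a * cexp (-(r * x)))
    (f' := fun x : ℝ ↦ a * ((x : ℂ) ^ (a - 1) * cexp (-(r * x))) -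
      r * ((x : ℂ) ^ (a + 1 - 1) * cexp (-(r * x)))) ?_ ?_ (h1.sub h2) ?_
  · rw [integral_sub h1 h2, integral_const_mul, integral_const_mul] at hFTC
    simp only [ofReal_zero, zero_cpow ha0, zero_mul, sub_zero] at hFTC
    exact (sub_eq_zero.mp hFTC).symm
  · exact ((continuous_ofReal_cpow_const ha).mul (by fun_prop)).continuousWithinAt
  · intro x hx
    have hpow : HasDerivAt (fun y : ℝ ↦ (y : ℂ) ^ a) (a * (x : ℂ) ^ (a - 1)) x := by
      simpa using (((hasDerivAt_id (x : ℂ)).cpow_const (c := a)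
        (Or.inl (by simpa using hx))).comp_ofReal)
    have hexp : HasDerivAt (fun y : ℝ ↦ cexp (-(r * y))) (cexp (-(r * x)) * -(r * 1)) x :=
      (((hasDerivAt_id (x : ℂ)).const_mul r).neg.cexp).comp_ofReal
    refine (hpow.mul hexp).congr_deriv ?_
    rw [add_sub_cancel_right]
    ring
  · rw [tendsto_zero_iff_norm_tendsto_zero]
    refine (tendsto_rpow_mul_exp_neg_mul_atTop_nhds_zero a.re r.re hr).congr' ?_
    filter_upwards [eventually_gt_atTop 0] with x hx
    simp [norm_cpow_eq_rpow_re_of_pos hx, norm_exp]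

/-- The density `x ^ (a - 1) * exp (-2πx)` on the positive half-line, extended by zero. -/
def gammaKernel (a : ℂ) : ℝ → ℂ :=
  (Ioi (0 : ℝ)).indicator fun x ↦ (x : ℂ) ^ (a - 1) * cexp (-(2 * π * x))

theorem integrable_gammaKernel {a : ℂ} (ha : 0 < a.re) : Integrable (gammaKernel a) := by
  refine IntegrableOn.integrable_indicator ?_ measurableSet_Ioi
  exact_mod_cast integrableOn_cpow_mul_cexp ha (r := (2 * π : ℝ)) (by simp [Real.pi_pos])

theorem continuous_gammaKernel {a : ℂ} (ha : 1 < a.re) : Continuous (gammaKernel a) := by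
  have ha0 : a - 1 ≠ 0 := fun h ↦ by
    have := congrArg re h
    simp at this
    linarith
  have heq : gammaKernel a = fun x : ℝ ↦ ((max x 0 : ℝ) : ℂ) ^ (a - 1) * cexp (-(2 * π * x)) := by
    ext x
    rcases lt_or_ge 0 x with hx | hx
    · simp [gammaKernel, hx, hx.le]
    · simp [gammaKernel, hx, ha0]
  rw [heq]
  exact ((continuous_ofReal_cpow_const (by simpa using ha)).comp
    (continuous_id.max continuous_const)).mul (by fun_prop)

theorem fourier_gammaKernel_eq_integral (a : ℂ) (ξ : ℝ) :
    𝓕 (gammaKernel a) ξ =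
      ∫ x in Ioi (0 : ℝ), (x : ℂ) ^ (a - 1) * cexp (-(2 * π * (1 + ξ * I) * x)) := by
  rw [Real.fourier_real_eq_integral_exp_smul, ← integral_indicator measurableSet_Ioi]
  congr with x
  by_cases hx : x ∈ Ioi (0 : ℝ)
  · simp only [gammaKernel, indicator_of_mem hx, smul_eq_mul]
    rw [mul_left_comm, ← Complex.exp_add]
    push_cast
    ring_nf
  · simp [gammaKernel, indicator_of_notMem hx]

theorem hasDerivAt_fourier_gammaKernel {a : ℂ} (ha : 0 < a.re) (ξ : ℝ) :
    HasDerivAt (𝓕 (gammaKernel a)) (-2 * π * I * 𝓕 (gammaKernel (a + 1)) ξ) ξ := by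
  have hmul (x : ℝ) : (x : ℂ) * gammaKernel a x = gammaKernel (a + 1) x := by
    by_cases hx : x ∈ Ioi (0 : ℝ)
    · have hx0 : (x : ℂ) ≠ 0 := by simpa using ne_of_gt hx
      simp only [gammaKernel, indicator_of_mem hx]
      rw [add_sub_right_comm, cpow_add _ _ hx0, cpow_one]
      ring
    · simp [gammaKernel, indicator_of_notMem hx]
  have hint : Integrable fun x : ℝ ↦ x • gammaKernel a x := by
    simp only [real_smul, hmul]
    exact integrable_gammaKernel (by simp; linarith)
  refine (Real.hasDerivAt_fourier (integrable_gammaKernel ha) hint ξ).congr_deriv ?_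
  simp only [smul_eq_mul, mul_assoc, hmul]
  simp only [Real.fourier_real_eq_integral_exp_smul, smul_eq_mul, ← integral_const_mul]
  congr with x
  ring

theorem one_add_mul_I_mem_slitPlane (ξ : ℝ) : 1 + ξ * I ∈ slitPlane := by
  simp [slitPlane]

theorem fourier_gammaKernel {a : ℂ} (ha : 0 < a.re) (ξ : ℝ) :
    𝓕 (gammaKernel a) ξ =
      (1 / (2 * π : ℝ) : ℂ) ^ a * Complex.Gamma a * (1 + ξ * I) ^ (-a) := by
  have hderiv (x : ℝ) :
      HasDerivAt (fun y : ℝ ↦ (1 + y * I) ^ a * 𝓕 (gammaKernel a) y) 0 x := by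
    have hbase : HasDerivAt (fun z : ℂ ↦ 1 + z * I) I x := by
      simpa using ((hasDerivAt_id (x : ℂ)).mul_const I).const_add 1
    have hne := slitPlane_ne_zero (one_add_mul_I_mem_slitPlane x)
    have hrec := mul_integral_cpow_mul_cexp (r := 2 * π * (1 + x * I)) ha
      (by simp [Real.pi_pos])
    rw [← fourier_gammaKernel_eq_integral, ← fourier_gammaKernel_eq_integral] at hrec
    refine (((hbase.cpow_const (c := a) (one_add_mul_I_mem_slitPlane x)).comp_ofReal).mul
      (hasDerivAt_fourier_gammaKernel ha x)).congr_deriv ?_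
    rw [cpow_sub _ _ hne, cpow_one]
    field_simp
    linear_combination -(I * (1 + x * I) ^ a) * hrec
  have hconst := is_const_of_deriv_eq_zero (fun x ↦ (hderiv x).differentiableAt)
    (fun x ↦ (hderiv x).deriv) ξ 0
  have hzero : 𝓕 (gammaKernel a) 0 = (1 / (2 * π : ℝ) : ℂ) ^ a * Complex.Gamma a := by
    rw [← integral_cpow_mul_exp_neg_mul_Ioi ha (by positivity : 0 < 2 * π),
      fourier_gammaKernel_eq_integral]
    simp
  have hne := slitPlane_ne_zero (one_add_mul_I_mem_slitPlane ξ)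
  simp only [ofReal_zero, zero_mul, add_zero, one_cpow, one_mul, hzero] at hconst
  rw [← hconst, cpow_neg]
  field_simp [cpow_eq_zero_iff, hne]

theorem integrable_fourier_gammaKernel {a : ℂ} (ha : 1 < a.re) :
    Integrable (𝓕 (gammaKernel a)) := by
  have ha' : 0 < a.re := by linarith
  have heq : 𝓕 (gammaKernel a) = fun ξ : ℝ ↦
      (1 / (2 * π : ℝ) : ℂ) ^ a * Complex.Gamma a * (1 + ξ * I) ^ (-a) :=
    funext (fourier_gammaKernel ha')
  rw [heq]
  refine Integrable.const_mul ?_ _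
  refine ((integrable_rpow_neg_one_add_norm_sq (E := ℝ) (μ := volume) (r := a.re)
    (by simpa using ha)).mul_const (Real.exp (π * |a.im|))).mono' ?_ ?_
  · refine Continuous.aestronglyMeasurable ?_
    exact Continuous.cpow (by fun_prop) continuous_const one_add_mul_I_mem_slitPlane
  · refine Eventually.of_forall fun ξ ↦ (norm_cpow_le _ _).trans ?_
    have hnorm : ‖(1 + ξ * I : ℂ)‖ = (1 + ‖ξ‖ ^ 2) ^ (1 / 2 : ℝ) := by
      rw [← Real.sqrt_eq_rpow, Complex.norm_def, normSq_apply]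
      simp [sq]
    rw [hnorm, ← Real.rpow_mul (by positivity), div_eq_mul_inv, ← Real.exp_neg]
    refine mul_le_mul (le_of_eq ?_) (Real.exp_le_exp.mpr ?_) (by positivity) (by positivity)
    · congr 1
      simp
      ring
    · rw [neg_im, mul_neg, neg_neg]
      refine (le_abs_self _).trans ?_
      rw [abs_mul]
      exact mul_le_mul_of_nonneg_right (abs_arg_le_pi _) (abs_nonneg _)

theorem integral_fourier_gammaKernel_mul_of_one_lt_right {a b : ℂ} (ha : 0 < a.re) (hb : 1 < b.re)
    (c : ℝ) :
    ∫ t : ℝ, 𝓕 (gammaKernel a) (-t) * 𝓕 (gammaKernel b) t * cexp (-2 * π * I * c * t) =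
      ∫ x : ℝ, gammaKernel a x * gammaKernel b (x - c) := by
  have hb' : 0 < b.re := by linarith
  have hFb := integrable_fourier_gammaKernel hb
  set G : ℝ → ℂ := fun t ↦ 𝓕 (gammaKernel b) (-t) * cexp (2 * π * I * c * t) with hG
  have hGint : Integrable G := by
    refine hFb.comp_neg.mono (hFb.comp_neg.aestronglyMeasurable.mul
      (Continuous.aestronglyMeasurable (by fun_prop))) (Eventually.of_forall fun t ↦ le_of_eq ?_)
    simp [hG, norm_exp]
  have hFG (x : ℝ) : 𝓕 G x = gammaKernel b (x - c) := by
    rw [← congrFun ((continuous_gammaKernel hb).fourierInv_fourier_eq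
      (integrable_gammaKernel hb') hFb) (x - c), Real.fourierInv_eq',
      Real.fourier_real_eq_integral_exp_smul, ← integral_neg_eq_self]
    congr with v
    simp only [hG, smul_eq_mul, neg_neg, RCLike.inner_apply, conj_trivial]
    rw [mul_left_comm, ← Complex.exp_add, mul_comm]
    push_cast
    ring_nf
  have hflip : ∫ ξ, 𝓕 (gammaKernel a) ξ • G ξ = ∫ x, gammaKernel a x • 𝓕 G x := by
    simpa using! VectorFourier.integral_fourierIntegral_smul_eq_flip (L := innerₗ ℝ)
      Real.continuous_fourierChar continuous_inner (integrable_gammaKernel ha) hGint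
  simp only [hFG, smul_eq_mul] at hflip
  rw [← hflip, ← integral_neg_eq_self]
  congr with t
  simp only [hG, neg_neg]
  push_cast
  ring_nf

theorem integral_gammaKernel_mul_sub (a b : ℂ) (c : ℝ) :
    ∫ x : ℝ, gammaKernel a x * gammaKernel b (x - c) =
      ∫ x : ℝ, gammaKernel b x * gammaKernel a (x - -c) := by
  rw [← integral_add_right_eq_self _ c]
  simp [mul_comm]

theorem integral_fourier_gammaKernel_mul {a b : ℂ} (ha : 0 < a.re) (hb : 0 < b.re)
    (hab : 2 < (a + b).re) (c : ℝ) :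
    ∫ t : ℝ, 𝓕 (gammaKernel a) (-t) * 𝓕 (gammaKernel b) t * cexp (-2 * π * I * c * t) =
      ∫ x : ℝ, gammaKernel a x * gammaKernel b (x - c) := by
  rcases lt_or_ge 1 b.re with h | h
  · exact integral_fourier_gammaKernel_mul_of_one_lt_right ha h c
  · have ha1 : 1 < a.re := by rw [add_re] at hab; linarith
    rw [integral_gammaKernel_mul_sub,
      ← integral_fourier_gammaKernel_mul_of_one_lt_right hb ha1 (-c), ← integral_neg_eq_self]
    congr with t
    push_cast
    ring_nf

theorem integral_gammaKernel_mul_of_pos (a b : ℂ) {c : ℝ} (hc : 0 < c) :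
    ∫ x : ℝ, gammaKernel a x * gammaKernel b (x - c) =
      (c : ℂ) ^ (a + b - 1) * cexp (-(2 * π * c)) *
        ∫ u in Ioi (0 : ℝ), cexp (-(4 * π * c * u : ℝ)) * ((u : ℂ) + 1) ^ (a - 1) *
          (u : ℂ) ^ (b - 1) := by
  have hc0 : (c : ℂ) ≠ 0 := by exact_mod_cast hc.ne'
  set g : ℝ → ℂ := fun x ↦
    (x : ℂ) ^ (b - 1) * ((x + c : ℝ) : ℂ) ^ (a - 1) * cexp (-(2 * π * (2 * x + c))) with hg
  have hK : ∫ x : ℝ, gammaKernel a x * gammaKernel b (x - c) = ∫ x in Ioi (0 : ℝ), g x := by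
    rw [integral_gammaKernel_mul_sub, ← integral_indicator measurableSet_Ioi]
    congr with x
    by_cases hx : x ∈ Ioi (0 : ℝ)
    · have hxc : x - -c ∈ Ioi (0 : ℝ) := by
        rw [sub_neg_eq_add]
        exact add_pos hx hc
      simp only [gammaKernel, indicator_of_mem hx, indicator_of_mem hxc, hg]
      rw [mul_mul_mul_comm, ← Complex.exp_add]
      push_cast
      ring_nf
    · simp [gammaKernel, indicator_of_notMem hx]
  have hsubst := integral_comp_mul_left_Ioi' g 0 hc
  rw [mul_zero] at hsubst
  rw [hK, ← hsubst, real_smul, ← integral_const_mul, ← integral_const_mul]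
  refine setIntegral_congr_fun measurableSet_Ioi fun u hu ↦ ?_
  have hu0 : (0 : ℝ) < u := hu
  have h1 : ((c * u + c : ℝ) : ℂ) = c * (u + 1 : ℝ) := by push_cast; ring
  simp only [hg]
  rw [h1, ofReal_mul, mul_cpow_ofReal_nonneg hc.le hu0.le,
    mul_cpow_ofReal_nonneg hc.le (by positivity),
    show a + b - 1 = 1 + (a - 1) + (b - 1) by ring, cpow_add _ _ hc0, cpow_add _ _ hc0, cpow_one,
    show -(2 * (π : ℂ) * (2 * (c * u) + c)) = -(2 * π * c) + -(4 * π * c * u : ℝ) by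
      push_cast; ring, Complex.exp_add]
  push_cast
  ring

theorem integral_gammaKernel_mul_self {a b : ℂ} (hab : 1 < (a + b).re) :
    ∫ x : ℝ, gammaKernel a x * gammaKernel b x =
      (1 / (4 * π : ℝ) : ℂ) ^ (a + b - 1) * Complex.Gamma (a + b - 1) := by
  rw [← integral_cpow_mul_exp_neg_mul_Ioi (by simpa using hab) (by positivity),
    ← integral_indicator measurableSet_Ioi]
  congr with x
  by_cases hx : x ∈ Ioi (0 : ℝ)
  · have hx0 : (x : ℂ) ≠ 0 := by simpa using ne_of_gt hx
    simp only [gammaKernel, indicator_of_mem hx]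
    rw [mul_mul_mul_comm, ← Complex.exp_add, ← cpow_add _ _ hx0]
    push_cast
    ring_nf
  · simp [gammaKernel, indicator_of_notMem hx]

theorem integral_eq_Gamma_mul_Omega {y : ℝ} (hy : 0 < y) (α : ℂ) {β : ℂ} (hβ : 0 < β.re) :
    ∫ u in Ioi (0 : ℝ), cexp (-(y * u : ℝ)) * ((u : ℂ) + 1) ^ (α - 1) * (u : ℂ) ^ (β - 1) =
      Complex.Gamma β * (y : ℂ) ^ (-β) * Omega y α β := by
  have hΓ := Gamma_ne_zero_of_re_pos hβ
  have hy0 : (y : ℂ) ^ β ≠ 0 := by simp [cpow_eq_zero_iff, hy.ne']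
  rw [Omega, cpow_neg]
  field_simp

theorem add_I_cpow_mul_sub_I_cpow (a b : ℂ) (t : ℝ) :
    ((t : ℂ) + I) ^ (-a) * ((t : ℂ) - I) ^ (-b) =
      I ^ (b - a) * ((1 + (-t : ℝ) * I) ^ (-a) * (1 + t * I) ^ (-b)) := by
  have harg (x : ℝ) : |arg (1 + x * I)| < π / 2 := by
    rw [abs_arg_lt_pi_div_two_iff]
    simp
  have hne (x : ℝ) : (1 + x * I : ℂ) ≠ 0 := slitPlane_ne_zero (one_add_mul_I_mem_slitPlane x)
  have h1 : (t : ℂ) + I = I * (1 + (-t : ℝ) * I) := by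
    push_cast
    linear_combination (t : ℂ) * I_sq
  have h2 : (t : ℂ) - I = -I * (1 + t * I) := by
    linear_combination (t : ℂ) * I_sq
  have hl1 : log (I * (1 + (-t : ℝ) * I)) = log I + log (1 + (-t : ℝ) * I) := by
    refine log_mul I_ne_zero (hne _) ?_
    have := abs_lt.mp (harg (-t))
    rw [arg_I]
    constructor <;> linarith [Real.pi_pos]
  have hl2 : log (-I * (1 + t * I)) = log (-I) + log (1 + t * I) := by
    refine log_mul (neg_ne_zero.mpr I_ne_zero) (hne _) ?_
    have := abs_lt.mp (harg t)
    rw [arg_neg_I]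
    constructor <;> linarith [Real.pi_pos]
  rw [h1, h2, cpow_def_of_ne_zero (mul_ne_zero I_ne_zero (hne _)),
    cpow_def_of_ne_zero (mul_ne_zero (neg_ne_zero.mpr I_ne_zero) (hne _)), hl1, hl2,
    cpow_def_of_ne_zero I_ne_zero, cpow_def_of_ne_zero (hne _), cpow_def_of_ne_zero (hne _),
    ← Complex.exp_add, ← Complex.exp_add, ← Complex.exp_add, log_I, log_neg_I]
  ring_nf

theorem ofReal_cpow_eq_cexp {x : ℝ} (hx : 0 < x) (w : ℂ) :
    (x : ℂ) ^ w = cexp (Real.log x * w) := by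
  rw [cpow_def_of_ne_zero (by exact_mod_cast hx.ne'), ofReal_log hx.le]

theorem integral_add_I_cpow_mul_sub_I_cpow {a b : ℂ} (ha : 0 < a.re) (hb : 0 < b.re)
    (hab : 2 < (a + b).re) (c : ℝ) :
    ∫ t : ℝ, ((t : ℂ) + I) ^ (-a) * ((t : ℂ) - I) ^ (-b) * cexp (-2 * π * I * c * t) =
      I ^ (b - a) * ((2 * π : ℝ) : ℂ) ^ (a + b) * (Complex.Gamma a)⁻¹ * (Complex.Gamma b)⁻¹ *
        ∫ x : ℝ, gammaKernel a x * gammaKernel b (x - c) := by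
  have hΓa := Gamma_ne_zero_of_re_pos ha
  have hΓb := Gamma_ne_zero_of_re_pos hb
  have hpos : 0 < 2 * π := by positivity
  have h2π : ((2 * π : ℝ) : ℂ) ≠ 0 := by exact_mod_cast hpos.ne'
  rw [← integral_fourier_gammaKernel_mul ha hb hab, ← integral_const_mul]
  congr with t
  have hinv (w : ℂ) : (1 / (2 * π : ℝ) : ℂ) ^ w = (((2 * π : ℝ) : ℂ) ^ w)⁻¹ := by
    rw [one_div, inv_cpow _ _ (by rw [arg_ofReal_of_nonneg hpos.le]; exact Real.pi_pos.ne)]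
  have hpow (w : ℂ) : ((2 * π : ℝ) : ℂ) ^ w ≠ 0 := by
    rw [ofReal_cpow_eq_cexp hpos]
    exact Complex.exp_ne_zero _
  rw [add_I_cpow_mul_sub_I_cpow, fourier_gammaKernel ha, fourier_gammaKernel hb, hinv, hinv,
    cpow_add _ _ h2π]
  field_simp [hpow a, hpow b]

theorem rho_eq_integral_gammaKernel {k : ℤ} {s : ℂ} (h : ℤ) (v : ℝ)
    (hs₁ : s.re > 3/4 - (k : ℝ)/2) (hs₂ : 0 < s.re) (hs₃ : 0 < ((k : ℂ) + 1/2 + s).re) :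
    rho k s h v = (v : ℂ) ^ ((1 : ℂ)/2 - (k : ℂ) - 2 * s) * cexp (2 * π * h * v) *
      (I ^ (-((k : ℂ) + 1/2)) * ((2 * π : ℝ) : ℂ) ^ ((k : ℂ) + 1/2 + 2 * s) *
        (Complex.Gamma ((k : ℂ) + 1/2 + s))⁻¹ * (Complex.Gamma s)⁻¹ *
        ∫ x : ℝ, gammaKernel ((k : ℂ) + 1/2 + s) x * gammaKernel s (x - h * v)) := by
  have hab : 2 < ((k : ℂ) + 1/2 + s + s).re := by
    norm_num
    linarith
  have hint := integral_add_I_cpow_mul_sub_I_cpow hs₃ hs₂ hab (h * v)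
  rw [show s - ((k : ℂ) + 1/2 + s) = -((k : ℂ) + 1/2) by ring,
    show (k : ℂ) + 1/2 + s + s = (k : ℂ) + 1/2 + 2 * s by ring] at hint
  rw [rho, ← hint]
  push_cast
  congr 2 with t
  rw [show -((k : ℂ) + 1/2) - s = -((k : ℂ) + 1/2 + s) by ring]
  ring_nf

/-- Evaluation of ϱ_h^{k+1/2}(s,v) in the three cases h > 0, h = 0, h < 0. -/
theorem rho_eval (k : ℤ) (v : ℝ) (hv : 0 < v) (h : ℤ) (s : ℂ)
    (hs₁ : s.re > 3/4 - (k : ℝ)/2) (hs₂ : 0 < s.re) (hs₃ : 0 < ((k : ℂ) + 1/2 + s).re) :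
    (0 < h →
      rho k s h v =
        (-2 * (Real.pi : ℂ) * Complex.I) ^ ((k : ℂ) + 1/2) * (Real.pi : ℂ) ^ s *
          (Complex.Gamma ((k : ℂ) + 1/2 + s))⁻¹ * (h : ℂ) ^ ((k : ℂ) - 1/2 + s) *
          (v : ℂ) ^ (-s) * Omega (4 * Real.pi * h * v) ((k : ℂ) + 1/2 + s) s) ∧
    (h = 0 →
      rho k s h v =
        Complex.I ^ (-((k : ℂ) + 1/2)) * (2 * (Real.pi : ℂ)) *
          (Complex.Gamma ((k : ℂ) + 1/2 + s))⁻¹ * (Complex.Gamma s)⁻¹ *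
          Complex.Gamma ((k : ℂ) - 1/2 + 2 * s) *
          ((2 * v : ℝ) : ℂ) ^ ((1 : ℂ)/2 - (k : ℂ) - 2 * s)) ∧
    (h < 0 →
      rho k s h v =
        (2 * Complex.I) ^ (-((k : ℂ) + 1/2)) * (Real.pi : ℂ) ^ s * (Complex.Gamma s)⁻¹ *
          ((-h : ℤ) : ℂ) ^ (s - 1) * (v : ℂ) ^ (-((k : ℂ) + 1/2) - s) *
          (Real.exp (4 * Real.pi * h * v) : ℂ) *
          Omega (-(4 * Real.pi * h * v)) s ((k : ℂ) + 1/2 + s)) := by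
  have hπ := Real.pi_pos
  have hΓa := Gamma_ne_zero_of_re_pos hs₃
  have hΓs := Gamma_ne_zero_of_re_pos hs₂
  have log_two_pi : Real.log (2 * π) = Real.log 2 + Real.log π :=
    Real.log_mul (by norm_num) hπ.ne'
  have log_four : Real.log 4 = 2 * Real.log 2 := by
    rw [show (4 : ℝ) = 2 ^ 2 by norm_num, Real.log_pow]
    norm_num
  refine ⟨fun hh ↦ ?_, fun hh ↦ ?_, fun hh ↦ ?_⟩
  · have hh' : (0 : ℝ) < h := by exact_mod_cast hh
    have hc : 0 < h * v := mul_pos hh' hv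
    have log_freq : Real.log (4 * π * h * v) =
        2 * Real.log 2 + Real.log π + Real.log h + Real.log v := by
      rw [Real.log_mul (by positivity) hv.ne', Real.log_mul (by positivity) hh'.ne',
        Real.log_mul (by norm_num) hπ.ne', log_four]
    have log_base : log (-2 * (π : ℂ) * I) = Real.log 2 + Real.log π - π / 2 * I := by
      rw [show -2 * (π : ℂ) * I = (2 * π : ℝ) * -I by push_cast; ring,
        log_ofReal_mul (by positivity) (by simp), log_neg_I, log_two_pi]
      push_cast
      ring
    rw [rho_eq_integral_gammaKernel h v hs₁ hs₂ hs₃, integral_gammaKernel_mul_of_pos _ _ hc,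
      show 4 * π * (h * v) = 4 * π * h * v by ring,
      integral_eq_Gamma_mul_Omega (by positivity) _ hs₂, ← ofReal_intCast h,
      ofReal_cpow_eq_cexp hv, ofReal_cpow_eq_cexp hv, ofReal_cpow_eq_cexp hh',
      ofReal_cpow_eq_cexp hc, ofReal_cpow_eq_cexp hπ, ofReal_cpow_eq_cexp (by positivity),
      ofReal_cpow_eq_cexp (by positivity), cpow_def_of_ne_zero I_ne_zero,
      cpow_def_of_ne_zero (by simp [hπ.ne']), log_base, log_I, log_freq, log_two_pi,
      Real.log_mul hh'.ne' hv.ne']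
    generalize Complex.Gamma ((k : ℂ) + 1/2 + s) = G at hΓa ⊢
    generalize Omega _ _ _ = W
    field_simp
    simp only [mul_assoc, ← Complex.exp_add]
    rw [mul_comm (cexp _)]
    congr 2
    push_cast
    ring
  · subst hh
    have hab : 1 < ((k : ℂ) + 1/2 + s + s).re := by
      norm_num
      linarith
    rw [rho_eq_integral_gammaKernel 0 v hs₁ hs₂ hs₃]
    simp only [Int.cast_zero, zero_mul, mul_zero, sub_zero, Complex.exp_zero, mul_one]
    rw [integral_gammaKernel_mul_self hab,
      show (k : ℂ) + 1/2 + s + s - 1 = (k : ℂ) - 1/2 + 2 * s by ring,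
      show (1 / (4 * π : ℝ) : ℂ) = ((4 * π)⁻¹ : ℝ) by push_cast; ring,
      show (2 * (π : ℂ)) = ((2 * π : ℝ) : ℂ) ^ (1 : ℂ) by simp,
      ofReal_cpow_eq_cexp hv, ofReal_cpow_eq_cexp (by positivity),
      ofReal_cpow_eq_cexp (by positivity), ofReal_cpow_eq_cexp (by positivity),
      ofReal_cpow_eq_cexp (by positivity), log_two_pi,
      Real.log_inv, Real.log_mul (by norm_num) hπ.ne', Real.log_mul (by norm_num) hv.ne', log_four,
      cpow_def_of_ne_zero I_ne_zero]
    generalize Complex.Gamma ((k : ℂ) + 1/2 + s) = G at hΓa ⊢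
    generalize Complex.Gamma ((k : ℂ) - 1/2 + 2 * s) = W
    field_simp
    simp only [mul_assoc, ← Complex.exp_add]
    rw [mul_comm (cexp _)]
    congr 2
    push_cast
    ring
  · have hh' : (0 : ℝ) < -h := by
      rw [neg_pos]
      exact_mod_cast hh
    have hc : 0 < -h * v := mul_pos hh' hv
    have log_freq : Real.log (4 * π * (-h * v)) =
        2 * Real.log 2 + Real.log π + Real.log (-h) + Real.log v := by
      rw [Real.log_mul (by positivity) hc.ne', Real.log_mul hh'.ne' hv.ne',
        Real.log_mul (by norm_num) hπ.ne', log_four]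
      ring
    have log_base : log (2 * I) = Real.log 2 + π / 2 * I := by
      rw [show (2 : ℂ) * I = (2 : ℝ) * I by push_cast; ring,
        log_ofReal_mul (by norm_num) I_ne_zero, log_I]
    rw [rho_eq_integral_gammaKernel h v hs₁ hs₂ hs₃, integral_gammaKernel_mul_sub,
      show -(h * v) = -h * v by ring, integral_gammaKernel_mul_of_pos _ _ hc,
      show -(4 * π * h * v) = 4 * π * (-h * v) by ring,
      integral_eq_Gamma_mul_Omega (by positivity) _ hs₃,
      show (((-h : ℤ) : ℂ)) = ((-h : ℝ) : ℂ) by push_cast; rfl,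
      ofReal_cpow_eq_cexp hv, ofReal_cpow_eq_cexp hv, ofReal_cpow_eq_cexp hh',
      ofReal_cpow_eq_cexp hc, ofReal_cpow_eq_cexp hπ, ofReal_cpow_eq_cexp (by positivity),
      ofReal_cpow_eq_cexp (by positivity), cpow_def_of_ne_zero I_ne_zero,
      cpow_def_of_ne_zero (by simp), log_base, log_I, log_freq, log_two_pi,
      Real.log_mul hh'.ne' hv.ne', ofReal_exp]
    generalize Complex.Gamma ((k : ℂ) + 1/2 + s) = G at hΓa ⊢
    generalize Omega _ _ _ = W
    field_simp
    simp only [mul_assoc, ← Complex.exp_add]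
    rw [mul_comm (cexp _)]
    congr 2
    push_cast
    ring

end
end

section
/- For every odd positive integer m and all integers k and h, ε_m^{−(2k+1)} m^{−1/2} Σ_{n=0}^{m−1} (n/m) e^{2πinh/m} = γ_m((−1)^k h), where (n/m) is the Jacobi symbol. -/
open Complex

noncomputable section

/-- ε_m for odd m: 1 if m ≡ 1 (mod 4), i if m ≡ 3 (mod 4). -/
def eps (d : ℤ) : ℂ := if d % 4 = 1 then 1 else Complex.I

/-- The Jacobi symbol modulo `m` as a function on `ZMod m`. -/
def jacobiZMod (m : ℕ) (x : ZMod m) : ℂ := (jacobiSym x.val m : ℂ)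

/-- The unnormalized Gauss sum of the Jacobi symbol modulo `m`. -/
def jacobiGaussSum (m : ℕ) [NeZero m] (h : ℤ) : ℂ :=
  ∑ x : ZMod m, jacobiZMod m x * ZMod.stdAddChar (x * (h : ZMod m))

theorem jacobiZMod_intCast (m : ℕ) [NeZero m] (n : ℤ) :
    jacobiZMod m (n : ZMod m) = (jacobiSym n m : ℂ) := by
  rw [jacobiZMod, ZMod.val_intCast, ← jacobiSym.mod_left]

theorem jacobiZMod_neg (m : ℕ) [NeZero m] (x : ZMod m) :
    jacobiZMod m (-x) = (jacobiSym (-1) m : ℂ) * jacobiZMod m x := by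
  obtain ⟨n, rfl⟩ := ZMod.intCast_surjective x
  rw [← Int.cast_neg, jacobiZMod_intCast, jacobiZMod_intCast, neg_eq_neg_one_mul,
    jacobiSym.mul_left, Int.cast_mul]

theorem sum_range_eq_sum_zmod (m : ℕ) [NeZero m] (g : ZMod m → ℂ) :
    ∑ n ∈ Finset.range m, g n = ∑ x : ZMod m, g x := by
  refine Finset.sum_bij' (fun n _ ↦ (n : ZMod m)) (fun x _ ↦ x.val) ?_ ?_ ?_ ?_ ?_
  · simp
  · intro x _
    simpa using ZMod.val_lt x
  · intro n hn
    exact ZMod.val_cast_of_lt (Finset.mem_range.mp hn)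
  · intro x _
    exact ZMod.natCast_zmod_val x
  · simp

theorem jacobiGaussSum_neg (m : ℕ) [NeZero m] (h : ℤ) :
    jacobiGaussSum m (-h) = (jacobiSym (-1) m : ℂ) * jacobiGaussSum m h := by
  rw [jacobiGaussSum, jacobiGaussSum, ← Equiv.sum_comp (Equiv.neg (ZMod m)), Finset.mul_sum]
  refine Finset.sum_congr rfl fun x _ ↦ ?_
  simp [jacobiZMod_neg, mul_assoc]

theorem sum_range_jacobiSym_mul_exp (m : ℕ) [NeZero m] (h : ℤ) :
    ∑ n ∈ Finset.range m,
      (jacobiSym n m : ℂ) * Complex.exp (2 * Real.pi * Complex.I * n * h / m) =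
      jacobiGaussSum m h := by
  rw [jacobiGaussSum, ← sum_range_eq_sum_zmod]
  refine Finset.sum_congr rfl fun n _ ↦ ?_
  have h1 := jacobiZMod_intCast m n
  have h2 := ZMod.stdAddChar_coe (N := m) (n * h)
  push_cast at h1 h2
  rw [h1, h2]
  congr 2
  ring

theorem sum_Icc_one_two_mul (F : ℕ → ℂ) (m : ℕ) :
    ∑ a ∈ Finset.Icc 1 (2 * m), F a =
      ∑ b ∈ Finset.range m, (F (2 * b + 1) + F (2 * b + 2)) := by
  induction m with
  | zero => simp
  | succ m ih =>
    rw [Finset.sum_range_succ, ← ih, Nat.mul_succ, Finset.sum_Icc_succ_top (by lia),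
      Finset.sum_Icc_succ_top (by lia), add_assoc]

theorem eps_of_mod_four_eq_one {d : ℤ} (h : d % 4 = 1) : eps d = 1 := if_pos h

theorem eps_of_mod_four_eq_three {d : ℤ} (h : d % 4 = 3) : eps d = Complex.I :=
  if_neg (by lia)

theorem exp_mul_jacobiSym_two {m : ℕ} (hm : Odd m) :
    Complex.exp (Real.pi * Complex.I * ((1 - (m : ℂ)) / 2) / 2) * (jacobiSym 2 m : ℂ) =
      eps m := by
  have hexp (q r : ℕ) : Complex.exp (Real.pi * Complex.I * ((1 - ((8 * q + r : ℕ) : ℂ)) / 2) / 2)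
      = Complex.exp (Real.pi * Complex.I * ((1 - (r : ℂ)) / 2) / 2) := by
    rw [Complex.exp_eq_exp_iff_exists_int]
    refine ⟨-q, ?_⟩
    push_cast
    ring
  have hpow (r : ℕ) (j : ℤ) (hr : (1 - (r : ℂ)) = 2 * j) :
      Complex.exp (Real.pi * Complex.I * ((1 - (r : ℂ)) / 2) / 2) = Complex.I ^ j := by
    rw [hr, ← congrArg (· ^ j) Complex.exp_pi_div_two_mul_I, ← Complex.exp_int_mul]
    congr 1
    ring
  rw [jacobiSym.at_two hm, ZMod.χ₈_nat_eq_if_mod_eight]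
  have hr : m % 8 = 1 ∨ m % 8 = 3 ∨ m % 8 = 5 ∨ m % 8 = 7 := by
    have := Nat.odd_iff.mp hm
    lia
  have hdiv := Nat.div_add_mod m 8
  have hexp' := hexp (m / 8) (m % 8)
  rw [hdiv] at hexp'
  rw [hexp']
  rcases hr with hr | hr | hr | hr
  · rw [eps_of_mod_four_eq_one (by lia), hr, hpow 1 0 (by norm_num)]
    simp [show m % 2 = 1 by lia]
  · rw [eps_of_mod_four_eq_three (by lia), hr, hpow 3 (-1) (by norm_num)]
    simp [show m % 2 = 1 by lia]
  · rw [eps_of_mod_four_eq_one (by lia), hr, hpow 5 (-2) (by norm_num)]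
    simp [show m % 2 = 1 by lia, zpow_neg]
  · rw [eps_of_mod_four_eq_three (by lia), hr, hpow 7 (-3) (by norm_num)]
    simp [show m % 2 = 1 by lia, zpow_neg]

theorem gaussG_eq_of_odd {m : ℕ} [NeZero m] (hm : Odd m) (n : ℤ) :
    gaussG m n = (m : ℂ) ^ (-(1 : ℂ) / 2) * (eps m * jacobiGaussSum m (-n)) := by
  rw [gaussG, sum_Icc_one_two_mul, jacobiGaussSum, ← Equiv.sum_comp (Equiv.addRight (1 : ZMod m)),
    ← sum_range_eq_sum_zmod, Finset.mul_sum _ _ (eps m)]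
  congr 1
  refine Finset.sum_congr rfl fun b _ ↦ ?_
  have hodd : lamb (2 * b + 1) m = 0 := by
    simp [lamb, hm]
  have heven : lamb (2 * b + 2) m = eps m * (jacobiSym (b + 1) m : ℂ) := by
    rw [lamb, if_pos ⟨hm, by simp [parity_simps]⟩, ← exp_mul_jacobiSym_two hm,
      mul_assoc (Complex.exp _), ← Int.cast_mul, ← jacobiSym.mul_left]
    push_cast
    rw [mul_add, mul_one]
  have h1 := jacobiZMod_intCast m (b + 1)
  have h2 := ZMod.stdAddChar_coe (N := m) ((b + 1) * -n)
  push_cast at h1 h2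
  rw [hodd, heven, zero_mul, zero_add, Equiv.coe_addRight, Int.cast_neg, h1, h2, mul_assoc]
  congr 3
  push_cast
  ring

theorem eps_pow_four (d : ℤ) : eps d ^ (4 : ℤ) = 1 := by
  rw [eps]
  split_ifs
  · simp
  · exact_mod_cast Complex.I_pow_four

theorem eps_ne_zero (d : ℤ) : eps d ≠ 0 := by
  rw [eps]
  split_ifs <;> simp

theorem eps_mul_jacobiSym_neg_one {m : ℕ} (hm : Odd m) :
    eps m * (jacobiSym (-1) m : ℂ) = (eps m)⁻¹ := by
  rw [jacobiSym.at_neg_one hm]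
  obtain hr | hr := Nat.odd_mod_four_iff.mp (Nat.odd_iff.mp hm)
  · rw [eps_of_mod_four_eq_one (by lia), ZMod.χ₄_nat_one_mod_four hr]
    simp
  · rw [eps_of_mod_four_eq_three (by lia), ZMod.χ₄_nat_three_mod_four hr]
    simp

theorem eps_zpow_four_mul_add (d j r : ℤ) : eps d ^ (4 * j + r) = eps d ^ r := by
  rw [zpow_add₀ (eps_ne_zero d), zpow_mul, eps_pow_four, one_zpow, one_mul]

/-- For odd m > 0: ε_m^{−(2k+1)} m^{−1/2} Σ_{n=0}^{m−1} (n/m) e^{2πinh/m} = γ_m((−1)^k h). -/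
theorem gauss_sum_odd (m : ℕ) (hm : Odd m) (hm0 : 0 < m) (k h : ℤ) :
    eps m ^ (-(2 * k + 1)) * (m : ℂ) ^ (-(1 : ℂ) / 2) *
        ∑ n ∈ Finset.range m,
          (jacobiSym n m : ℂ) * Complex.exp (2 * Real.pi * Complex.I * n * h / m) =
      gaussG m ((k.negOnePow : ℤ) * h) := by
  have : NeZero m := ⟨hm0.ne'⟩
  rw [sum_range_jacobiSym_mul_exp, gaussG_eq_of_odd hm]
  obtain ⟨j, rfl | rfl⟩ := Int.even_or_odd' k
  · rw [show -(2 * (2 * j) + 1) = 4 * -j + -1 by ring, eps_zpow_four_mul_add, zpow_neg_one,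
      Int.negOnePow_two_mul, Units.val_one, one_mul, jacobiGaussSum_neg,
      ← eps_mul_jacobiSym_neg_one hm]
    ring
  · rw [show -(2 * (2 * j + 1) + 1) = 4 * (-j - 1) + 1 by ring, eps_zpow_four_mul_add, zpow_one,
      Int.negOnePow_two_mul_add_one, Units.val_neg, Units.val_one, neg_one_mul, neg_neg]
    ring

end
end

section
/- For every even positive integer n and all integers k and h, √2 · n^{−1/2} Σ_{ℓ odd, 0 < ℓ < 2n} (2n/ℓ) ε_ℓ^{−(2k+1)} e^{−2πiℓh/(2n)} = (1 + i^{2k−1}) γ_n((−1)^k h), where (2n/ℓ) is the Jacobi symbol with (odd positive) denominator ℓ. -/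
open Complex

noncomputable section

/-- For odd `l`, the eighth root of unity `e^{πi(l-1)/4}` equals `(2/l) ε_l⁻¹`. -/
theorem one_sub_I_mul_exp_eq (l : ℕ) (hl : Odd l) :
    (1 - I) * exp (Real.pi * I * ((l : ℂ) / 2) / 2) =
      (Real.sqrt 2 : ℝ) * ((jacobiSym 2 l : ℂ) * (eps l)⁻¹) := by
  obtain ⟨m, rfl⟩ := hl
  have hexp : exp (Real.pi * I * (((2 * m + 1 : ℕ) : ℂ) / 2) / 2) =
      exp ((Real.pi / 4 : ℝ) * I) * I ^ m := by
    have hI : I ^ m = exp (m * (Real.pi / 2 * I)) := by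
      rw [exp_nat_mul, exp_pi_div_two_mul_I]
    rw [hI, ← exp_add]
    congr 1
    push_cast
    ring
  have hbase : (1 - I) * exp ((Real.pi / 4 : ℝ) * I) = (Real.sqrt 2 : ℝ) := by
    rw [exp_mul_I, ← ofReal_cos, ← ofReal_sin, Real.cos_pi_div_four, Real.sin_pi_div_four]
    push_cast
    linear_combination (-(Real.sqrt 2 : ℂ) / 2) * I_sq
  rw [hexp, ← mul_assoc, hbase, jacobiSym.at_two ⟨m, rfl⟩]
  congr 1
  have hm : m % 4 = 0 ∨ m % 4 = 1 ∨ m % 4 = 2 ∨ m % 4 = 3 := by omega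
  rw [ZMod.χ₈_nat_eq_if_mod_eight, eps, ← Nat.div_add_mod m 4, pow_add, pow_mul, I_pow_four]
  rcases hm with h | h | h | h
  · have h1 : (2 * (4 * (m / 4) + 0) + 1) % 8 = 1 := by omega
    have h2 : ((2 * (4 * (m / 4) + 0) + 1 : ℕ) : ℤ) % 4 = 1 := by omega
    have h3 : (2 * (4 * (m / 4) + 0) + 1) % 2 ≠ 0 := by omega
    rw [h, if_pos h2, if_neg h3, if_pos (Or.inl h1)]
    simp
  · have h1 : (2 * (4 * (m / 4) + 1) + 1) % 8 = 3 := by omega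
    have h2 : ((2 * (4 * (m / 4) + 1) + 1 : ℕ) : ℤ) % 4 ≠ 1 := by omega
    have h3 : (2 * (4 * (m / 4) + 1) + 1) % 2 ≠ 0 := by omega
    rw [h, if_neg h2, if_neg h3, if_neg (by omega)]
    simp
  · have h1 : (2 * (4 * (m / 4) + 2) + 1) % 8 = 5 := by omega
    have h2 : ((2 * (4 * (m / 4) + 2) + 1 : ℕ) : ℤ) % 4 = 1 := by omega
    have h3 : (2 * (4 * (m / 4) + 2) + 1) % 2 ≠ 0 := by omega
    rw [h, if_pos h2, if_neg h3, if_neg (by omega)]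
    simp
  · have h1 : (2 * (4 * (m / 4) + 3) + 1) % 8 = 7 := by omega
    have h2 : ((2 * (4 * (m / 4) + 3) + 1 : ℕ) : ℤ) % 4 ≠ 1 := by omega
    have h3 : (2 * (4 * (m / 4) + 3) + 1) % 2 ≠ 0 := by omega
    rw [h, if_neg h2, if_neg h3, if_pos (Or.inr h1)]
    simp

theorem one_sub_I_mul_lamb (n l : ℕ) (hn : Even n) (hl : Odd l) :
    (1 - I) * lamb l n =
      (Real.sqrt 2 : ℝ) * ((jacobiSym (2 * n) l : ℂ) * (eps l)⁻¹) := by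
  rw [lamb, if_neg (fun h => Nat.not_even_iff_odd.2 hl h.2), if_pos ⟨hl, hn⟩, ← mul_assoc,
    one_sub_I_mul_exp_eq l hl, jacobiSym.mul_left]
  push_cast
  ring

theorem one_sub_I_mul_gaussG (n : ℕ) (hn : Even n) (m : ℤ) :
    (1 - I) * gaussG n m =
      (Real.sqrt 2 : ℝ) * (n : ℂ) ^ (-(1 : ℂ) / 2) *
        ∑ l ∈ (Finset.range (2 * n)).filter (fun l => Odd l),
          (jacobiSym (2 * n) l : ℂ) * (eps l)⁻¹ * exp (-Real.pi * I * m * l / n) := by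
  have hsum : ∑ a ∈ Finset.Icc 1 (2 * n), lamb a n * exp (-Real.pi * I * m * a / n) =
      ∑ l ∈ (Finset.range (2 * n)).filter (fun l => Odd l),
        lamb l n * exp (-Real.pi * I * m * l / n) := by
    symm
    apply Finset.sum_subset
    · intro l
      simp only [Finset.mem_filter, Finset.mem_range, Finset.mem_Icc]
      rintro ⟨h, h'⟩
      exact ⟨h'.pos, h.le⟩
    · intro l hl hl'
      have hodd : ¬ Odd l := by
        intro h
        simp only [Finset.mem_filter, Finset.mem_range, Finset.mem_Icc] at hl hl'
        have : l ≠ 2 * n := by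
          rintro rfl
          exact Nat.not_odd_iff_even.2 (even_two_mul n) h
        exact hl' ⟨by omega, h⟩
      rw [lamb, if_neg (fun h => Nat.not_even_iff_odd.2 h.1 hn), if_neg (fun h => hodd h.1),
        zero_mul]
  rw [gaussG, hsum, Finset.mul_sum, Finset.mul_sum, Finset.mul_sum]
  refine Finset.sum_congr rfl fun l hl => ?_
  linear_combination (n : ℂ) ^ (-(1 : ℂ) / 2) * exp (-Real.pi * I * m * l / n) *
    one_sub_I_mul_lamb n l hn (Finset.mem_filter.1 hl).2

/-- `(N/·)` is even under `l ↦ N - l` when `4 ∣ N`. -/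
theorem jacobiSym_reflect {N l l' : ℕ} (hN : 4 ∣ N) (hadd : l' + l = N) (hl : Odd l) :
    jacobiSym N l' = jacobiSym N l := by
  have hl' : Odd l' := by
    obtain ⟨t, ht⟩ := hN
    obtain ⟨s, hs⟩ := hl
    exact ⟨2 * t - s - 1, by omega⟩
  have h1 : jacobiSym N l' = jacobiSym l l' :=
    jacobiSym.mod_left' (by rw [← hadd]; push_cast; simp)
  have h2 : jacobiSym N l = jacobiSym l' l :=
    jacobiSym.mod_left' (by rw [← hadd]; push_cast; simp)
  rw [h1, h2]
  have h4 : l % 4 = 1 ∨ l' % 4 = 1 := by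
    obtain ⟨s, hs⟩ := hl
    omega
  rcases h4 with h | h
  · exact jacobiSym.quadratic_reciprocity_one_mod_four h hl'
  · exact (jacobiSym.quadratic_reciprocity_one_mod_four h hl).symm

theorem I_mul_inv_eps_reflect {N l l' : ℕ} (hN : 4 ∣ N) (hadd : l' + l = N) (hl : Odd l) :
    I * (eps l')⁻¹ = eps l := by
  obtain ⟨s, hs⟩ := hl
  by_cases h : (l : ℤ) % 4 = 1
  · rw [eps, eps, if_pos h, if_neg (by omega), mul_inv_cancel₀ I_ne_zero]
  · rw [eps, eps, if_neg h, if_pos (by omega), inv_one, mul_one]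

theorem zpow_eq_of_zpow_four {z : ℂ} (hz : z ^ (4 : ℤ) = 1) (h0 : z ≠ 0) {a b j : ℤ}
    (h : a = b + 4 * j) : z ^ a = z ^ b := by
  rw [h, zpow_add₀ h0, zpow_mul, hz, one_zpow, mul_one]

theorem sum_odd_reflect (n : ℕ) (f : ℕ → ℂ) :
    ∑ l ∈ (Finset.range (2 * n)).filter (fun l => Odd l), f (2 * n - l) =
      ∑ l ∈ (Finset.range (2 * n)).filter (fun l => Odd l), f l := by
  have hmem : ∀ l ∈ (Finset.range (2 * n)).filter (fun l => Odd l),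
      2 * n - l ∈ (Finset.range (2 * n)).filter (fun l => Odd l) := by
    intro l
    simp only [Finset.mem_filter, Finset.mem_range]
    rintro ⟨h, s, hs⟩
    exact ⟨by omega, n - s - 1, by omega⟩
  have hinv : ∀ l ∈ (Finset.range (2 * n)).filter (fun l => Odd l), 2 * n - (2 * n - l) = l := by
    intro l
    simp only [Finset.mem_filter, Finset.mem_range]
    rintro ⟨h, -⟩
    omega
  exact Finset.sum_bij' (fun l _ => 2 * n - l) (fun l _ => 2 * n - l) hmem hmem hinv hinv
    fun _ _ => rfl

/-- For even n > 0: √2 n^{−1/2} Σ_{ℓ odd, 0 < ℓ < 2n} (2n/ℓ) ε_ℓ^{−(2k+1)} e^{−2πiℓh/(2n)}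
= (1 + i^{2k−1}) γ_n((−1)^k h). -/
theorem gauss_sum_even (n : ℕ) (hn : Even n) (hn0 : 0 < n) (k h : ℤ) :
    ((Real.sqrt 2 : ℝ) : ℂ) * (n : ℂ) ^ (-(1 : ℂ) / 2) *
        ∑ l ∈ (Finset.range (2 * n)).filter (fun l => Odd l),
          (jacobiSym (2 * n) l : ℂ) * eps l ^ (-(2 * k + 1)) *
            Complex.exp (-2 * Real.pi * Complex.I * l * h / (2 * n)) =
      (1 + Complex.I ^ (2 * k - 1)) * gaussG n ((k.negOnePow : ℤ) * h) := by
  have hI4 : I ^ (4 : ℤ) = 1 := mod_cast I_pow_four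
  have hn' : (n : ℂ) ≠ 0 := Nat.cast_ne_zero.2 hn0.ne'
  rcases Int.even_or_odd' k with ⟨j, rfl | rfl⟩
  · rw [Int.negOnePow_even _ (even_two_mul j),
      zpow_eq_of_zpow_four hI4 I_ne_zero (b := -1) (j := j) (by ring), zpow_neg_one, inv_I,
      ← sub_eq_add_neg, one_sub_I_mul_gaussG n hn]
    congr 1
    refine Finset.sum_congr rfl fun l _ => ?_
    rw [zpow_eq_of_zpow_four (eps_pow_four l) (eps_ne_zero l) (b := -1) (j := -j) (by ring),
      zpow_neg_one]
    congr 2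
    push_cast
    field_simp
  · have hI : 1 + I ^ (2 * (2 * j + 1) - 1) = I * (1 - I) := by
      rw [zpow_eq_of_zpow_four hI4 I_ne_zero (b := 1) (j := j) (by ring), zpow_one]
      linear_combination I_sq
    rw [Int.negOnePow_odd _ (odd_two_mul_add_one j), hI, mul_assoc I,
      one_sub_I_mul_gaussG n hn, mul_left_comm I]
    congr 1
    conv_rhs => rw [← sum_odd_reflect n, Finset.mul_sum]
    refine Finset.sum_congr rfl fun l hl => ?_
    obtain ⟨hlt, hodd⟩ := Finset.mem_filter.1 hl
    have hadd : 2 * n - l + l = 2 * n := Nat.sub_add_cancel (Finset.mem_range.1 hlt).le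
    have hdvd : 4 ∣ 2 * n := mul_dvd_mul_left 2 hn.two_dvd
    have hexp : exp (-Real.pi * I * (((-1 : ℤˣ) : ℤ) * h : ℤ) * (2 * n - l : ℕ) / n) =
        exp (-2 * Real.pi * I * l * h / (2 * n)) := by
      rw [exp_eq_exp_iff_exists_int]
      refine ⟨h, ?_⟩
      rw [Nat.cast_sub (Finset.mem_range.1 hlt).le]
      push_cast
      field_simp
      ring
    have hJ := jacobiSym_reflect hdvd hadd hodd
    push_cast at hJ
    rw [zpow_eq_of_zpow_four (eps_pow_four l) (eps_ne_zero l) (b := 1) (j := -j - 1) (by ring),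
      zpow_one, hexp, hJ, ← I_mul_inv_eps_reflect hdvd hadd hodd]
    ring

end
end

section
/- For every integer n ≥ 1 and every τ = u + iv ∈ ℍ, ξ_{3/2}( Γ(−1/2, 4πn²v) e^{−2πin²τ} ) = −(4πn²)^{−1/2} e^{2πin²τ}; that is, applying the shadow operator of weight 3/2 to the n-th term of the nonholomorphic part of Zagier's mock modular form produces −(1/(2√π n)) times the n-th term of the theta function. -/
open Complex MeasureTheory

noncomputable section

/-- The incomplete Gamma value Γ(−1/2, x) = ∫ₓ^∞ e^{−t} t^{−3/2} dt. -/
def incGammaNegHalf (x : ℝ) : ℝ := ∫ t in Set.Ioi x, Real.exp (-t) * t ^ (-(3:ℝ)/2)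

/-- The antiholomorphic Wirtinger derivative ∂f/∂τ̄ = (1/2)(∂f/∂u + i ∂f/∂v). -/
def dbar (f : ℂ → ℂ) (τ : ℂ) : ℂ :=
  (1/2) * (fderiv ℝ f τ 1 + Complex.I * fderiv ℝ f τ Complex.I)

/-- The shadow operator ξ_{3/2}(f)(τ) = 2i v^{3/2} conj(∂f/∂τ̄(τ)). -/
def xiThreeHalves (f : ℂ → ℂ) (τ : ℂ) : ℂ :=
  2 * Complex.I * ((τ.im ^ ((3:ℝ)/2) : ℝ) : ℂ) * (starRingEnd ℂ) (dbar f τ)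

/-- The integrand defining `incGammaNegHalf` is integrable on every half-line `(c, ∞)`, `c > 0`. -/
lemma integrableOn_exp_neg_mul_rpow {c : ℝ} (hc : 0 < c) (s : ℝ) :
    IntegrableOn (fun t : ℝ => Real.exp (-t) * t ^ s) (Set.Ioi c) :=
  integrable_of_isBigO_exp_neg one_half_pos
    (continuousOn_id.neg.rexp.mul
      (continuousOn_id.rpow_const fun _ ht => Or.inl (hc.trans_le ht).ne'))
    (Real.Gamma_integrand_isLittleO s).isBigO

lemma hasDerivAt_incGammaNegHalf {x : ℝ} (hx : 0 < x) :
    HasDerivAt incGammaNegHalf (-(Real.exp (-x) * x ^ (-(3:ℝ)/2))) x := by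
  have hc : 0 < x / 2 := half_pos hx
  have hcont : ContinuousOn (fun t : ℝ => Real.exp (-t) * t ^ (-(3:ℝ)/2)) (Set.Ioi 0) :=
    continuousOn_id.neg.rexp.mul
      (continuousOn_id.rpow_const fun _ ht => Or.inl (ne_of_gt ht))
  have hint : ∀ y, x / 2 < y → IntervalIntegrable
      (fun t : ℝ => Real.exp (-t) * t ^ (-(3:ℝ)/2)) volume (x / 2) y := fun y hy =>
    (intervalIntegrable_iff_integrableOn_Ioc_of_le hy.le).2
      ((integrableOn_exp_neg_mul_rpow hc _).mono_set Set.Ioc_subset_Ioi_self)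
  have hderiv := intervalIntegral.integral_hasDerivAt_right (hint x (half_lt_self hx))
    (hcont.stronglyMeasurableAtFilter isOpen_Ioi x hx)
    (hcont.continuousAt (Ioi_mem_nhds hx))
  refine (hderiv.const_sub (incGammaNegHalf (x / 2))).congr_of_eventuallyEq ?_
  filter_upwards [Ioi_mem_nhds (half_lt_self hx)] with y hy
  rw [incGammaNegHalf, incGammaNegHalf, eq_sub_iff_add_eq',
    intervalIntegral.integral_interval_add_Ioi (integrableOn_exp_neg_mul_rpow hc _)
      (integrableOn_exp_neg_mul_rpow (hc.trans hy) _)]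

/-- The Wirtinger derivative `∂/∂τ̄` of `g(a v) E(τ)` with `E` holomorphic. -/
lemma dbar_ofReal_comp_im_mul {g : ℝ → ℝ} {g' a : ℝ} {E : ℂ → ℂ} {E' τ : ℂ}
    (hg : HasDerivAt g g' (a * τ.im)) (hE : HasDerivAt E E' τ) :
    dbar (fun z => (g (a * z.im) : ℂ) * E z) τ = Complex.I / 2 * (a * g') * E τ := by
  have him : HasFDerivAt (fun z : ℂ => a * z.im) (a • Complex.imCLM) τ :=
    Complex.imCLM.hasFDerivAt.const_mul a
  have hre := Complex.ofRealCLM.hasFDerivAt.comp τ (hg.comp_hasFDerivAt τ him)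
  have hF := hre.mul (hE.hasFDerivAt.restrictScalars ℝ)
  have hfd : fderiv ℝ (fun z : ℂ => (g (a * z.im) : ℂ) * E z) τ = _ := hF.fderiv
  rw [dbar, hfd]
  simp
  linear_combination (1/2 * g (a * τ.im) * E') * Complex.I_mul_I

/-- Applying ξ_{3/2} to the n-th term Γ(−1/2, 4πn²v) e^{−2πin²τ} of the nonholomorphic part
of Zagier's mock modular form yields −(4πn²)^{−1/2} e^{2πin²τ}. -/
theorem xi_term (n : ℕ) (hn : 1 ≤ n) (τ : ℂ) (hτ : 0 < τ.im) :
    xiThreeHalves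
      (fun z => (incGammaNegHalf (4 * Real.pi * (n : ℝ)^2 * z.im) : ℂ) *
        Complex.exp (-2 * Real.pi * Complex.I * (n : ℂ)^2 * z)) τ
    = -(((4 * Real.pi * (n : ℝ)^2) ^ (-(1:ℝ)/2) : ℝ) : ℂ) *
        Complex.exp (2 * Real.pi * Complex.I * (n : ℂ)^2 * τ) := by
  have hn0 : (0:ℝ) < n := by exact_mod_cast hn
  have ha : 0 < 4 * Real.pi * (n : ℝ)^2 := by positivity
  have hE : HasDerivAt (fun z : ℂ => Complex.exp (-2 * Real.pi * Complex.I * (n : ℂ)^2 * z))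
      _ τ := ((hasDerivAt_id τ).const_mul _).cexp
  have hexp : Complex.exp (2 * Real.pi * Complex.I * (n : ℂ)^2 * τ) =
      Complex.exp (-(4 * Real.pi * (n : ℝ)^2 * τ.im : ℝ)) *
        (starRingEnd ℂ) (Complex.exp (-2 * Real.pi * Complex.I * (n : ℂ)^2 * τ)) := by
    rw [← Complex.exp_conj, ← Complex.exp_add]
    congr 1
    apply Complex.ext <;> simp [pow_two]
    ring
  rw [xiThreeHalves, dbar_ofReal_comp_im_mul (hasDerivAt_incGammaNegHalf (mul_pos ha hτ)) hE, hexp]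
  generalize Complex.exp (-2 * Real.pi * Complex.I * (n : ℂ)^2 * τ) = w
  generalize 4 * Real.pi * (n : ℝ)^2 = a at ha
  have hpow : τ.im ^ ((3:ℝ)/2) * (a * (a * τ.im) ^ (-(3:ℝ)/2)) = a ^ (-(1:ℝ)/2) := by
    have h1 : a * a ^ (-(3:ℝ)/2) = a ^ (-(1:ℝ)/2) := by
      rw [← Real.rpow_one_add' ha.le (by norm_num)]
      norm_num
    have h2 : τ.im ^ ((3:ℝ)/2) * τ.im ^ (-(3:ℝ)/2) = 1 := by
      rw [← Real.rpow_add hτ]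
      norm_num
    rw [Real.mul_rpow ha.le hτ.le]
    linear_combination h2 * (a * a ^ (-(3:ℝ)/2)) + h1
  rw [← hpow]
  simp only [map_mul, map_div₀, Complex.conj_I, Complex.conj_ofReal, map_ofNat]
  push_cast
  linear_combination (τ.im ^ ((3:ℝ)/2) : ℝ) * (a * ((a * τ.im) ^ (-(3:ℝ)/2) : ℝ)) *
    Complex.exp (-(a * τ.im)) * (starRingEnd ℂ) w * Complex.I_mul_I

end
end
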